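/- Let A be an M×N real matrix, x, s ∈ ℝ^N, w ∈ ℝ^M, and y = Ax + w. If E[(s−x)ᵀAᵀw] = 0, E[wᵀw] = Mσ², each entry of s−x is i.i.d. with mean zero so that E[(s−x)ᵀAᵀA(s−x)] = (1/N)·tr(AᵀA)·E[‖s−x‖²], and tr(AᵀA) ≠ 0, then (E[‖y − As‖²] − Mσ²)/tr(AᵀA) = (1/N)·E[‖s−x‖²]. -/

import Mathlib

open Matrix MeasureTheory

lemma Matrix.dotProduct_transpose_mulVec_sub {m n R : Type*} [Fintype m] [Fintype n] [CommRing R]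
    (A : Matrix m n R) (u v : n → R) (w : m → R) :
    (u - v) ⬝ᵥ (Aᵀ *ᵥ w) = -((A *ᵥ (v - u)) ⬝ᵥ w) := by
  rw [dotProduct_mulVec, vecMul_transpose, ← neg_sub v u, mulVec_neg, neg_dotProduct]

lemma Matrix.dotProduct_transpose_mul_self_mulVec_sub {m n R : Type*} [Fintype m] [Fintype n]
    [CommRing R] (A : Matrix m n R) (u v : n → R) :
    (u - v) ⬝ᵥ ((Aᵀ * A) *ᵥ (u - v)) = (A *ᵥ (v - u)) ⬝ᵥ (A *ᵥ (v - u)) := by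
  rw [← mulVec_mulVec, dotProduct_transpose_mulVec_sub, ← neg_sub v u, mulVec_neg,
    dotProduct_neg, neg_neg]

theorem tista_error_variance_estimator {M N : ℕ} (hN : 0 < N)
    {Ω : Type*} [MeasurableSpace Ω] (μ : Measure Ω)
    (A : Matrix (Fin M) (Fin N) ℝ)
    (x s : Ω → Fin N → ℝ) (w : Ω → Fin M → ℝ) (y : Ω → Fin M → ℝ)
    (σ : ℝ)
    (hy : ∀ ω, y ω = A *ᵥ x ω + w ω)
    (hcross : ∫ ω, (s ω - x ω) ⬝ᵥ (Aᵀ *ᵥ w ω) ∂μ = 0)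
    (hw : ∫ ω, (w ω) ⬝ᵥ (w ω) ∂μ = (M : ℝ) * σ ^ 2)
    (hiid : ∫ ω, (s ω - x ω) ⬝ᵥ ((Aᵀ * A) *ᵥ (s ω - x ω)) ∂μ
      = (1 / (N : ℝ)) * (Aᵀ * A).trace * ∫ ω, (s ω - x ω) ⬝ᵥ (s ω - x ω) ∂μ)
    (htr : (Aᵀ * A).trace ≠ 0)
    (hint1 : Integrable (fun ω => (A *ᵥ (x ω - s ω)) ⬝ᵥ (A *ᵥ (x ω - s ω))) μ)
    (hint2 : Integrable (fun ω => (A *ᵥ (x ω - s ω)) ⬝ᵥ w ω) μ)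
    (hint3 : Integrable (fun ω => (w ω) ⬝ᵥ (w ω)) μ) :
    ((∫ ω, (y ω - A *ᵥ s ω) ⬝ᵥ (y ω - A *ᵥ s ω) ∂μ) - (M : ℝ) * σ ^ 2)
        / (Aᵀ * A).trace
      = (1 / (N : ℝ)) * ∫ ω, (s ω - x ω) ⬝ᵥ (s ω - x ω) ∂μ := by
  have hexpand : ∀ ω, (y ω - A *ᵥ s ω) ⬝ᵥ (y ω - A *ᵥ s ω)
      = (A *ᵥ (x ω - s ω)) ⬝ᵥ (A *ᵥ (x ω - s ω)) + 2 * ((A *ᵥ (x ω - s ω)) ⬝ᵥ w ω)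
        + w ω ⬝ᵥ w ω := by
    intro ω
    have hres : y ω - A *ᵥ s ω = A *ᵥ (x ω - s ω) + w ω := by
      rw [hy, mulVec_sub]
      abel
    rw [hres, add_dotProduct, dotProduct_add, dotProduct_add, dotProduct_comm (w ω) (A *ᵥ _)]
    ring
  simp only [dotProduct_transpose_mulVec_sub, integral_neg, neg_eq_zero] at hcross
  simp only [dotProduct_transpose_mul_self_mulVec_sub] at hiid
  simp only [hexpand]
  rw [integral_add (hint1.fun_add (hint2.const_mul 2)) hint3,
    integral_add hint1 (hint2.const_mul 2),
    integral_const_mul, hcross, hw, hiid, div_eq_iff htr]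
  ring
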